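/- Let k be a positive integer and r > 0 a real number. Let G be a graph equipped with a rational-valued length-function ℓ. Suppose G contains an ℓ-geodesic cycle C with ℓ(C) ≥ 2rk which is the 𝔽₂-sum of a family of cycles of G each of ℓ-length at most r. Then the tree-width of G is at least k. -/

import Mathlib

open SimpleGraph

/-- A tree-decomposition of a graph `G`. -/
structure TreeDecomp {V : Type u} (G : SimpleGraph V) : Type (u + 1) where
  ι : Type u
  T : SimpleGraph ι
  conn : T.Connected
  acyc : T.IsAcyclic
  bag : ι → Set V
  covers : ∀ v : V, ∃ i, v ∈ bag i
  coversEdges : ∀ ⦃x y : V⦄, G.Adj x y → ∃ i, x ∈ bag i ∧ y ∈ bag i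
  coherent : ∀ (v : V) ⦃i j : ι⦄ (p : T.Walk i j), p.IsPath → v ∈ bag i → v ∈ bag j →
      ∀ k ∈ p.support, v ∈ bag k

/-- The width of a tree-decomposition: maximum bag size minus one. -/
noncomputable def TreeDecomp.width {V : Type u} {G : SimpleGraph V} (td : TreeDecomp G) : ℕ :=
  (⨆ i, (td.bag i).ncard) - 1

/-- The tree-width of a graph: the minimum width of a tree-decomposition. -/
noncomputable def treewidth {V : Type u} (G : SimpleGraph V) : ℕ :=
  sInf {w | ∃ td : TreeDecomp G, td.width = w}

/-- The `ℓ`-length of a walk: the sum of the lengths of its edges. -/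
def walkLen {V : Type u} {G : SimpleGraph V} (ℓ : Sym2 V → ℚ) {a b : V} (p : G.Walk a b) : ℚ :=
  (p.edges.map ℓ).sum

/-- A closed walk `c` is `ℓ`-geodesic: between any two of its vertices it contains a path
whose `ℓ`-length is minimum among all paths of `G` between those vertices. -/
def IsGeodesic {V : Type u} {G : SimpleGraph V} (ℓ : Sym2 V → ℚ) {v : V} (c : G.Walk v v) :
    Prop :=
  ∀ a ∈ c.support, ∀ b ∈ c.support,
    ∃ p : G.Walk a b, p.IsPath ∧ (∀ e ∈ p.edges, e ∈ c.edges) ∧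
      ∀ q : G.Walk a b, q.IsPath → walkLen ℓ p ≤ walkLen ℓ q

namespace SimpleGraph

lemma IsAcyclic.path_support_subset {ι : Type*} {T : SimpleGraph ι} (hT : T.IsAcyclic)
    {i j : ι} {p : T.Walk i j} (hp : p.IsPath) (q : T.Walk i j) : p.support ⊆ q.support := by
  classical
  have h : p = q.bypass := congrArg Subtype.val
    ((hT.subsingleton_path i j).elim ⟨p, hp⟩ ⟨_, q.bypass_isPath⟩)
  rw [h]
  exact q.support_bypass_subset_support

/-- A set of nodes is path-convex if it contains every path between any two of its nodes. -/
def PathConvex {ι : Type*} (T : SimpleGraph ι) (S : Set ι) : Prop :=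
  ∀ ⦃i j⦄ (p : T.Walk i j), p.IsPath → i ∈ S → j ∈ S → ∀ k ∈ p.support, k ∈ S

lemma PathConvex.inter {ι : Type*} {T : SimpleGraph ι} {S S' : Set ι} (h : T.PathConvex S)
    (h' : T.PathConvex S') : T.PathConvex (S ∩ S') :=
  fun _ _ p hp hi hj k hk => ⟨h p hp hi.1 hj.1 k hk, h' p hp hi.2 hj.2 k hk⟩

lemma IsTree.inter_three_nonempty {ι : Type*} {T : SimpleGraph ι} (hT : T.IsTree)
    {S₁ S₂ S₃ : Set ι} (h₁ : T.PathConvex S₁) (h₂ : T.PathConvex S₂) (h₃ : T.PathConvex S₃)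
    (h₁₂ : (S₁ ∩ S₂).Nonempty) (h₂₃ : (S₂ ∩ S₃).Nonempty) (h₁₃ : (S₁ ∩ S₃).Nonempty) :
    (S₁ ∩ (S₂ ∩ S₃)).Nonempty := by
  classical
  obtain ⟨b, hb₂, hb₃⟩ := h₂₃
  obtain ⟨a, ha₁, ha₂⟩ := h₁₂
  obtain ⟨c, hc₁, hc₃⟩ := h₁₃
  obtain ⟨q, hq⟩ := (hT.1.preconnected c a).exists_isPath
  have hsub := h₁ q hq hc₁ ha₁
  clear hc₁ ha₁
  induction q with
  | nil => exact ⟨_, hsub _ (by simp), ha₂, hc₃⟩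
  | @cons c c' a hadj q ih =>
    by_cases hc₂ : c ∈ S₂
    · exact ⟨c, hsub c (by simp), hc₂, hc₃⟩
    by_cases hc' : c' ∈ S₃
    · exact ih ha₂ hc' hq.of_cons fun k hk => hsub k (by simp [hk])
    exfalso
    obtain ⟨s, hs⟩ := (hT.1.preconnected c b).exists_isPath
    obtain ⟨t, ht⟩ := (hT.1.preconnected a b).exists_isPath
    have hpath : (Walk.cons hadj.symm s).IsPath :=
      hs.cons fun h => hc' (h₃ s hs hc₃ hb₃ _ h)
    have hmem := hT.2.path_support_subset hpath (q.append t) (show c ∈ _ by simp)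
    rcases Walk.mem_support_append_iff _ _ |>.1 hmem with h | h
    · exact ((Walk.cons_isPath_iff _ _).1 hq).2 h
    · exact hc₂ (h₂ t ht ha₂ hb₂ _ h)

/-- The Helly property of subtrees of a tree. -/
lemma IsTree.helly {ι α : Type*} {T : SimpleGraph ι} (hT : T.IsTree) (s : Finset α)
    (S : α → Set ι) (hS : ∀ a ∈ s, T.PathConvex (S a))
    (hpair : ∀ a ∈ s, ∀ b ∈ s, (S a ∩ S b).Nonempty) : ∃ i, ∀ a ∈ s, i ∈ S a := by
  classical
  induction s using Finset.induction_on generalizing S with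
  | empty => exact hT.1.nonempty.elim fun i => ⟨i, by simp⟩
  | insert a s ha ih =>
    have haS := hS a (by simp)
    rcases s.eq_empty_or_nonempty with rfl | ⟨b, hb⟩
    · obtain ⟨i, hi⟩ := hpair a (by simp) a (by simp)
      exact ⟨i, by simpa using hi.1⟩
    obtain ⟨i, hi⟩ := ih (fun b => S a ∩ S b)
      (fun b hb => haS.inter (hS b (by simp [hb])))
      (fun b hb d hd => by
        obtain ⟨i, h₁, h₂, h₃⟩ := hT.inter_three_nonempty haS (hS b (by simp [hb]))
          (hS d (by simp [hd])) (hpair a (by simp) b (by simp [hb]))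
          (hpair b (by simp [hb]) d (by simp [hd])) (hpair a (by simp) d (by simp [hd]))
        exact ⟨i, ⟨h₁, h₂⟩, h₁, h₃⟩)
    refine ⟨i, fun d hd => ?_⟩
    rcases Finset.mem_insert.1 hd with rfl | hd
    · exact (hi b hb).1
    · exact (hi d hd).2

lemma exists_walk_covering_component {V : Type*} [Fintype V] [DecidableEq V]
    (H : SimpleGraph V) (y : V) : ∃ (z : V) (p : H.Walk y z),
      (∀ x, H.Reachable y x → x ∈ p.support) ∧ p.length + 2 ≤ 2 * p.support.toFinset.card := by
  by_contra! hcon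
  have key : ∀ n : ℕ, ∃ (z : V) (p : H.Walk y z), n ≤ p.support.toFinset.card ∧
      p.length + 2 ≤ 2 * p.support.toFinset.card := by
    intro n
    induction n with
    | zero => exact ⟨y, .nil, by simp⟩
    | succ n ih =>
      obtain ⟨z, p, hn, hlen⟩ := ih
      have hx : ∃ x, H.Reachable y x ∧ x ∉ p.support := by
        by_contra! h
        exact absurd hlen (by have := hcon z p h; omega)
      obtain ⟨x, ⟨w⟩, hx⟩ := hx
      obtain ⟨d, -, ha, hb⟩ := w.exists_boundary_dart {v | v ∈ p.support} (by simp) hx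
      simp only [Set.mem_ofPred_eq] at ha hb
      refine ⟨z, (p.takeUntil _ ha).append (.cons d.adj (.cons d.adj.symm (p.dropUntil _ ha))),
        ?_⟩
      set p' := (p.takeUntil _ ha).append (.cons d.adj (.cons d.adj.symm (p.dropUntil _ ha)))
      have hl : p'.length = p.length + 2 := by
        have := congrArg Walk.length (p.take_spec ha)
        simp only [Walk.length_append] at this
        simp only [p', Walk.length_append, Walk.length_cons]
        omega
      have hs : insert d.snd p.support.toFinset ⊆ p'.support.toFinset := by
        intro v hv
        simp only [Finset.mem_insert, List.mem_toFinset] at hv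
        simp only [p', List.mem_toFinset, Walk.mem_support_append_iff, Walk.support_cons,
          List.mem_cons]
        rcases hv with rfl | hv
        · simp
        · rw [← p.take_spec ha, Walk.mem_support_append_iff] at hv
          tauto
      have hc := Finset.card_le_card hs
      rw [Finset.card_insert_of_notMem (by simpa using hb)] at hc
      omega
  obtain ⟨z, p, hn, -⟩ := key (Fintype.card V + 1)
  have := p.support.toFinset.card_le_univ
  omega

lemma Walk.IsCycle.exists_cut_getVert {V : Type*} {G : SimpleGraph V} {v : V} {c : G.Walk v v}
    (hc : c.IsCycle) {i j : ℕ} (hij : i < j) (hj : j < c.length) :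
    ∃ A : Set V, (∀ a ∈ A, a ∈ c.support) ∧ ∀ m < c.length,
      (¬(c.getVert m ∈ A ↔ c.getVert (m + 1) ∈ A) ↔ m = i ∨ m = j) := by
  have hinj := hc.getVert_injOn
  have hmem : ∀ m, m ≤ c.length →
      ((∃ t, i < t ∧ t ≤ j ∧ c.getVert t = c.getVert m) ↔ i < m ∧ m ≤ j) := by
    intro m hm
    refine ⟨?_, fun h => ⟨m, h.1, h.2, rfl⟩⟩
    rintro ⟨t, h₁, h₂, h₃⟩
    rcases Nat.eq_zero_or_pos m with rfl | hm0
    · rw [Walk.getVert_zero] at h₃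
      have := (hc.getVert_endpoint_iff (by omega)).1 h₃
      omega
    · have := hinj (show t ∈ {i | 1 ≤ i ∧ i ≤ c.length} from ⟨by omega, by omega⟩)
        (show m ∈ {i | 1 ≤ i ∧ i ≤ c.length} from ⟨by omega, hm⟩) h₃
      omega
  refine ⟨{x | ∃ t, i < t ∧ t ≤ j ∧ c.getVert t = x}, ?_, fun m hm => ?_⟩
  · rintro _ ⟨t, -, -, rfl⟩
    exact c.getVert_mem_support t
  · rw [Set.mem_ofPred_eq, Set.mem_ofPred_eq, hmem m hm.le, hmem (m + 1) hm]
    omega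

/-- Any two edges of a cycle form a cut of that cycle. -/
lemma Walk.IsCycle.exists_cut {V : Type*} {G : SimpleGraph V} {v : V} {c : G.Walk v v}
    (hc : c.IsCycle) {e e' : Sym2 V} (he : e ∈ c.edges) (he' : e' ∈ c.edges) (hne : e ≠ e') :
    ∃ A : Set V, (∀ a ∈ A, a ∈ c.support) ∧
      ∀ a b, s(a, b) ∈ c.edges → (¬(a ∈ A ↔ b ∈ A) ↔ s(a, b) = e ∨ s(a, b) = e') := by
  obtain ⟨i, hi, rfl⟩ := List.mem_iff_getElem.1 he
  obtain ⟨j, hj, rfl⟩ := List.mem_iff_getElem.1 he'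
  wlog hij : i < j generalizing i j
  · obtain ⟨A, hA, h⟩ := this j hj he' i hi he hne.symm
      (lt_of_le_of_ne (not_lt.1 hij) fun h => hne (by subst h; rfl))
    exact ⟨A, hA, fun a b hab => (h a b hab).trans or_comm⟩
  obtain ⟨A, hA, h⟩ := hc.exists_cut_getVert hij (by simpa using hj)
  refine ⟨A, hA, fun a b hab => ?_⟩
  obtain ⟨m, hm, hab⟩ := List.mem_iff_getElem.1 hab
  have hnd := hc.edges_nodup
  have hm' := h m (by simpa using hm)
  rw [← hab, hnd.getElem_inj_iff, hnd.getElem_inj_iff, ← hm']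
  rw [Walk.getElem_edges, Sym2.eq_iff] at hab
  rcases hab with ⟨rfl, rfl⟩ | ⟨rfl, rfl⟩
  · rfl
  · tauto

end SimpleGraph

lemma walkLen_append {V : Type*} {G : SimpleGraph V} (ℓ : Sym2 V → ℚ) {a b d : V}
    (p : G.Walk a b) (q : G.Walk b d) : walkLen ℓ (p.append q) = walkLen ℓ p + walkLen ℓ q := by
  simp [walkLen]

lemma walkLen_reverse {V : Type*} {G : SimpleGraph V} (ℓ : Sym2 V → ℚ) {a b : V}
    (p : G.Walk a b) : walkLen ℓ p.reverse = walkLen ℓ p := by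
  simp [walkLen, List.sum_reverse]

lemma walkLen_eq_sum {V : Type*} [DecidableEq V] {G : SimpleGraph V} (ℓ : Sym2 V → ℚ) {a b : V}
    (p : G.Walk a b) (hp : p.edges.Nodup) : walkLen ℓ p = ∑ e ∈ p.edges.toFinset, ℓ e :=
  (List.sum_toFinset ℓ hp).symm

lemma walkLen_bypass_le {V : Type*} [DecidableEq V] {G : SimpleGraph V} (ℓ : Sym2 V → ℚ)
    (hℓ : ∀ e ∈ G.edgeSet, 0 < ℓ e) {a b : V} (p : G.Walk a b) :
    walkLen ℓ p.bypass ≤ walkLen ℓ p := by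
  refine (p.edges_bypass_sublist_edges.map ℓ).sum_le_sum fun x hx => ?_
  obtain ⟨e, he, rfl⟩ := List.mem_map.1 hx
  exact (hℓ e (p.edges_subset_edgeSet he)).le

/-- Two vertices of a closed walk are joined by a walk of at most half its length. -/
lemma exists_walk_two_mul_walkLen_le {V : Type*} [DecidableEq V] {G : SimpleGraph V}
    (ℓ : Sym2 V → ℚ) {u x y : V} (d : G.Walk u u) (hx : x ∈ d.support) (hy : y ∈ d.support) :
    ∃ q : G.Walk x y, 2 * walkLen ℓ q ≤ walkLen ℓ d := by
  have hrot : walkLen ℓ (d.rotate x hx) = walkLen ℓ d :=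
    ((d.rotate_edges x hx).perm.map ℓ).sum_eq
  have hy' : y ∈ (d.rotate x hx).support := (d.mem_support_rotate_iff x hx).2 hy
  have hsplit := congrArg (walkLen ℓ) ((d.rotate x hx).take_spec hy')
  rw [walkLen_append, hrot] at hsplit
  rcases le_total (walkLen ℓ ((d.rotate x hx).takeUntil y hy'))
    (walkLen ℓ ((d.rotate x hx).dropUntil y hy')) with h | h
  · exact ⟨_, by linarith⟩
  · exact ⟨((d.rotate x hx).dropUntil y hy').reverse, by rw [walkLen_reverse]; linarith⟩

/-- A function on edges that is a coboundary along a walk telescopes. -/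
lemma sum_map_edges_eq {V : Type*} {G : SimpleGraph V} (φ : Sym2 V → ZMod 2) (h : V → ZMod 2)
    {a b : V} (p : G.Walk a b) (hφ : ∀ x y, s(x, y) ∈ p.edges → φ s(x, y) = h x + h y) :
    (p.edges.map φ).sum = h a + h b := by
  induction p with
  | nil => simp [CharTwo.add_self_eq_zero]
  | @cons a a' b hadj p ih =>
    rw [SimpleGraph.Walk.edges_cons, List.map_cons, List.sum_cons, hφ a a' (by simp),
      ih fun x y hxy => hφ x y (by simp [hxy])]
    have := CharTwo.add_self_eq_zero (h a')
    linear_combination this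

/-- In a geodesic closed walk `c`, the vertices of `c` that are visited by a walk made of jumps of
length at most `R` can be joined cheaply along `c`. -/
lemma IsGeodesic.exists_joining_edges {V : Type*} [DecidableEq V] {G : SimpleGraph V}
    {ℓ : Sym2 V → ℚ} (hℓ : ∀ e ∈ G.edgeSet, 0 < ℓ e) {v : V} {c : G.Walk v v}
    (hgeo : IsGeodesic ℓ c) {H : SimpleGraph V} {R : ℝ}
    (hH : ∀ a b, H.Adj a b → ∃ q : G.Walk a b, (walkLen ℓ q : ℝ) ≤ R)
    {a b : V} (p : H.Walk a b) (c₀ : V) (hc₀ : c₀ ∈ c.support) (q₀ : G.Walk c₀ a) :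
    ∃ N : Finset (Sym2 V), N ⊆ c.edges.toFinset ∧
      ((∑ e ∈ N, ℓ e : ℚ) : ℝ) ≤ walkLen ℓ q₀ + R * p.length ∧
      ∀ y ∈ p.support, y ∈ c.support →
        (SimpleGraph.fromEdgeSet (N : Set (Sym2 V))).Reachable c₀ y := by
  have hstep : ∀ (c₀ a : V) (_ : c₀ ∈ c.support) (_ : a ∈ c.support) (q₀ : G.Walk c₀ a),
      ∃ N : Finset (Sym2 V), N ⊆ c.edges.toFinset ∧ ∑ e ∈ N, ℓ e ≤ walkLen ℓ q₀ ∧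
        (SimpleGraph.fromEdgeSet (N : Set (Sym2 V))).Reachable c₀ a := by
    intro c₀ a hc₀ ha q₀
    obtain ⟨p, hp, hpc, hmin⟩ := hgeo c₀ hc₀ a ha
    refine ⟨p.edges.toFinset, fun e he => by simpa using hpc e (by simpa using he), ?_, ?_⟩
    · rw [← walkLen_eq_sum ℓ p hp.isTrail.edges_nodup]
      exact (hmin _ q₀.bypass_isPath).trans (walkLen_bypass_le ℓ hℓ q₀)
    · refine ⟨p.transfer _ fun e he => ?_⟩
      rw [SimpleGraph.edgeSet_fromEdgeSet]
      exact ⟨by simpa using he, G.not_isDiag_of_mem_edgeSet (p.edges_subset_edgeSet he)⟩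
  induction p generalizing c₀ with
  | @nil a =>
    by_cases ha : a ∈ c.support
    · obtain ⟨N, h₁, h₂, h₃⟩ := hstep c₀ a hc₀ ha q₀
      refine ⟨N, h₁, by simpa using mod_cast h₂, ?_⟩
      intro y hy _
      rw [SimpleGraph.Walk.support_nil, List.mem_singleton] at hy
      exact hy ▸ h₃
    · refine ⟨∅, by simp, ?_, ?_⟩
      · have : 0 ≤ walkLen ℓ q₀ := List.sum_nonneg fun x hx => by
          obtain ⟨e, he, rfl⟩ := List.mem_map.1 hx
          exact (hℓ e (q₀.edges_subset_edgeSet he)).le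
        simpa using mod_cast this
      · intro y hy hyc
        rw [SimpleGraph.Walk.support_nil, List.mem_singleton] at hy
        exact absurd (hy ▸ hyc) ha
  | @cons a a' b hadj p ih =>
    obtain ⟨q, hq⟩ := hH a a' hadj
    by_cases ha : a ∈ c.support
    · obtain ⟨N, h₁, h₂, h₃⟩ := hstep c₀ a hc₀ ha q₀
      obtain ⟨N', h₁', h₂', h₃'⟩ := ih a ha q
      have hle : SimpleGraph.fromEdgeSet (N : Set (Sym2 V)) ≤
          SimpleGraph.fromEdgeSet ((N ∪ N' : Finset _) : Set (Sym2 V)) :=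
        SimpleGraph.fromEdgeSet_mono (by simp)
      have hle' : SimpleGraph.fromEdgeSet (N' : Set (Sym2 V)) ≤
          SimpleGraph.fromEdgeSet ((N ∪ N' : Finset _) : Set (Sym2 V)) :=
        SimpleGraph.fromEdgeSet_mono (by simp)
      refine ⟨N ∪ N', Finset.union_subset h₁ h₁', ?_, ?_⟩
      · have hu : ∑ e ∈ N ∪ N', ℓ e ≤ ∑ e ∈ N, ℓ e + ∑ e ∈ N', ℓ e := by
          rw [← Finset.sum_union_inter]
          refine le_add_of_nonneg_right (Finset.sum_nonneg fun e he => ?_)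
          have := h₁ (Finset.mem_inter.1 he).1
          exact (hℓ e (c.edges_subset_edgeSet (by simpa using this))).le
        have hu' : ((∑ e ∈ N ∪ N', ℓ e : ℚ) : ℝ) ≤
            (∑ e ∈ N, ℓ e : ℚ) + (∑ e ∈ N', ℓ e : ℚ) := mod_cast hu
        have h₂'' : ((∑ e ∈ N, ℓ e : ℚ) : ℝ) ≤ walkLen ℓ q₀ := mod_cast h₂
        rw [SimpleGraph.Walk.length_cons]
        push_cast at *
        linarith
      · intro y hy hyc
        rw [SimpleGraph.Walk.support_cons, List.mem_cons] at hy
        rcases hy with rfl | hy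
        · exact h₃.mono hle
        · exact (h₃.mono hle).trans ((h₃' y hy hyc).mono hle')
    · obtain ⟨N, h₁, h₂, h₃⟩ := ih c₀ hc₀ (q₀.append q)
      refine ⟨N, h₁, ?_, ?_⟩
      · rw [walkLen_append] at h₂
        rw [SimpleGraph.Walk.length_cons]
        push_cast at *
        linarith
      · intro y hy hyc
        rw [SimpleGraph.Walk.support_cons, List.mem_cons] at hy
        rcases hy with rfl | hy
        · exact absurd hyc ha
        · exact h₃ y hy hyc

lemma IsGeodesic.exists_joining_edges_of_component {V : Type*} [Fintype V] [DecidableEq V]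
    {G : SimpleGraph V} {ℓ : Sym2 V → ℚ} (hℓ : ∀ e ∈ G.edgeSet, 0 < ℓ e) {v : V} {c : G.Walk v v}
    (hgeo : IsGeodesic ℓ c) {H : SimpleGraph V} {r : ℝ} (hr : 0 < r)
    (hH : ∀ a b, H.Adj a b → ∃ q : G.Walk a b, 2 * (walkLen ℓ q : ℝ) ≤ r)
    {Y : Finset V} {y : V} (hy : y ∈ c.support) (hY : ∀ x, H.Reachable y x → x ∈ Y) :
    ∃ N : Finset (Sym2 V), N ⊆ c.edges.toFinset ∧
      ((∑ e ∈ N, ℓ e : ℚ) : ℝ) ≤ r * (Y.card - 1 : ℕ) ∧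
      ∀ x ∈ c.support, H.Reachable y x →
        (SimpleGraph.fromEdgeSet (N : Set (Sym2 V))).Reachable y x := by
  obtain ⟨z, p, hcov, hlen⟩ := H.exists_walk_covering_component y
  obtain ⟨N, h₁, h₂, h₃⟩ := hgeo.exists_joining_edges hℓ (R := r / 2)
    (fun a b hab => (hH a b hab).imp fun q hq => by linarith) p y hy .nil
  refine ⟨N, h₁, h₂.trans ?_, fun x hx hyx => h₃ x (hcov x hyx) hx⟩
  have hcard : p.support.toFinset.card ≤ Y.card := Finset.card_le_card fun x hx =>
    hY x (p.takeUntil x (by simpa using hx)).reachable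
  have hle : p.length ≤ 2 * (Y.card - 1) := by omega
  have hle' : (p.length : ℝ) ≤ 2 * (Y.card - 1 : ℕ) := mod_cast hle
  have h0 : walkLen ℓ (.nil : G.Walk y y) = 0 := by simp [walkLen]
  rw [h0]
  push_cast
  nlinarith

/-- If `H` is a graph of short jumps between vertices of a set `X` of at most `k` vertices, then
the vertices of a geodesic closed walk `c` lying in a common component of `H` can be joined by
edges of `c` of total length less than `r * k`. -/
lemma IsGeodesic.exists_joining_edges_lt {V : Type*} [Fintype V] [DecidableEq V]
    {G : SimpleGraph V} {ℓ : Sym2 V → ℚ} (hℓ : ∀ e ∈ G.edgeSet, 0 < ℓ e) {v : V} {c : G.Walk v v}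
    (hgeo : IsGeodesic ℓ c) {H : SimpleGraph V} {r : ℝ} (hr : 0 < r)
    (hH : ∀ a b, H.Adj a b → ∃ q : G.Walk a b, 2 * (walkLen ℓ q : ℝ) ≤ r)
    {X : Finset V} (hHX : ∀ a b, H.Adj a b → a ∈ X) {k : ℕ} (hk : 0 < k) (hX : X.card ≤ k) :
    ∃ N : Finset (Sym2 V), N ⊆ c.edges.toFinset ∧ ((∑ e ∈ N, ℓ e : ℚ) : ℝ) < r * k ∧
      ∀ y ∈ c.support, ∀ y' ∈ c.support, H.Reachable y y' →
        (SimpleGraph.fromEdgeSet (N : Set (Sym2 V))).Reachable y y' := by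
  classical
  have hmemX : ∀ a b, H.Reachable a b → a ≠ b → a ∈ X := by
    rintro a b ⟨w⟩ hab
    cases w with
    | nil => exact absurd rfl hab
    | cons h _ => exact hHX _ _ h
  have hcomp : ∀ d : H.ConnectedComponent, ∃ N : Finset (Sym2 V), N ⊆ c.edges.toFinset ∧
      ((∑ e ∈ N, ℓ e : ℚ) : ℝ) ≤
        r * ((X.filter fun x => H.connectedComponentMk x = d).card - 1 : ℕ) ∧
      ∀ y ∈ X, y ∈ c.support → H.connectedComponentMk y = d → ∀ y' ∈ c.support,
        H.Reachable y y' → (SimpleGraph.fromEdgeSet (N : Set (Sym2 V))).Reachable y y' := by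
    intro d
    by_cases hd : ∃ y ∈ X, y ∈ c.support ∧ H.connectedComponentMk y = d
    · obtain ⟨y, hyX, hyc, rfl⟩ := hd
      obtain ⟨N, h₁, h₂, h₃⟩ := hgeo.exists_joining_edges_of_component hℓ hr hH
        (Y := X.filter fun x => H.connectedComponentMk x = H.connectedComponentMk y) hyc
        (fun x hx => by
          rw [Finset.mem_filter]
          refine ⟨?_, SimpleGraph.ConnectedComponent.eq.2 hx.symm⟩
          by_cases hxy : x = y
          · exact hxy ▸ hyX
          · exact hmemX x y hx.symm hxy)
      refine ⟨N, h₁, h₂, fun a _ hac had b hbc hab => ?_⟩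
      have hya : H.Reachable y a := (SimpleGraph.ConnectedComponent.eq.1 had).symm
      exact (h₃ a hac hya).symm.trans (h₃ b hbc (hya.trans hab))
    · refine ⟨∅, by simp, ?_, fun y hyX hyc hyd => absurd ⟨y, hyX, hyc, hyd⟩ hd⟩
      simpa using by positivity
  choose N hNc hNlen hN using hcomp
  set S := X.image H.connectedComponentMk
  refine ⟨S.biUnion N, Finset.biUnion_subset.2 fun d _ => hNc d, ?_, ?_⟩
  · have hsum : ∀ S' : Finset H.ConnectedComponent,
        ∑ e ∈ S'.biUnion N, ℓ e ≤ ∑ d ∈ S', ∑ e ∈ N d, ℓ e := by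
      intro S'
      induction S' using Finset.induction_on with
      | empty => simp
      | insert d S' hd ih =>
        rw [Finset.biUnion_insert, Finset.sum_insert hd]
        refine le_trans ?_ (add_le_add_right ih _)
        rw [← Finset.sum_union_inter]
        refine le_add_of_nonneg_right (Finset.sum_nonneg fun e he => ?_)
        have := hNc d (Finset.mem_inter.1 he).1
        exact (hℓ e (c.edges_subset_edgeSet (by simpa using this))).le
    have hsum' : ((∑ e ∈ S.biUnion N, ℓ e : ℚ) : ℝ) ≤ ∑ d ∈ S, ((∑ e ∈ N d, ℓ e : ℚ) : ℝ) :=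
      mod_cast hsum S
    refine hsum'.trans_lt ?_
    have hkX : r * X.card ≤ r * k := by gcongr
    rcases X.eq_empty_or_nonempty with hX0 | hX0
    · have : S = ∅ := by simp [S, hX0]
      rw [this, Finset.sum_empty]
      positivity
    · refine lt_of_lt_of_le ?_ hkX
      rw [Finset.card_eq_sum_card_image H.connectedComponentMk X, Nat.cast_sum, Finset.mul_sum]
      refine Finset.sum_lt_sum_of_nonempty (hX0.image _) fun d hd => (hNlen d).trans_lt ?_
      obtain ⟨x, hx, hxd⟩ := Finset.mem_image.1 hd
      have hpos : 0 < (X.filter fun x => H.connectedComponentMk x = d).card :=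
        Finset.card_pos.2 ⟨x, Finset.mem_filter.2 ⟨hx, hxd⟩⟩
      have : (((X.filter fun x => H.connectedComponentMk x = d).card - 1 : ℕ) : ℝ) <
          (X.filter fun x => H.connectedComponentMk x = d).card := mod_cast Nat.sub_lt hpos one_pos
      gcongr
  · intro y hy y' hy' hyy'
    by_cases hne : y = y'
    · rw [hne]
    have hyX := hmemX y y' hyy' hne
    refine (hN _ y hyX hy rfl y' hy' hyy').mono (SimpleGraph.fromEdgeSet_mono ?_)
    exact_mod_cast Finset.subset_biUnion_of_mem N (Finset.mem_image_of_mem _ hyX)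

/-- A cut of the cycle `c` in two edges outside `N` does not separate vertices joined by `N`. -/
lemma mem_iff_mem_of_reachable_fromEdgeSet {V : Type*} {G : SimpleGraph V} {v : V}
    {c : G.Walk v v} {N : Set (Sym2 V)} (hNc : ∀ e ∈ N, e ∈ c.edges) {e e' : Sym2 V}
    (heN : e ∉ N) (heN' : e' ∉ N) {A : Set V}
    (hA : ∀ a b, s(a, b) ∈ c.edges → (¬(a ∈ A ↔ b ∈ A) ↔ s(a, b) = e ∨ s(a, b) = e'))
    {y y' : V} (h : (SimpleGraph.fromEdgeSet N).Reachable y y') : y ∈ A ↔ y' ∈ A := by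
  obtain ⟨w⟩ := h
  induction w with
  | nil => rfl
  | @cons a b d hab w ih =>
    rw [SimpleGraph.fromEdgeSet_adj] at hab
    refine Iff.trans ?_ ih
    by_contra h
    rcases (hA a b (hNc _ hab.1)).1 h with h | h
    · exact heN (h ▸ hab.1)
    · exact heN' (h ▸ hab.1)

/-- Let `c` be the `𝔽₂`-sum of cycles `D i`, let `H` join any two vertices of `X` on a common
`D i`, and let `N` be a set of edges of `c` joining any two vertices of `c` in a common component
of `H`. If a set `K` has all its neighbours in `X` and meets one edge of `c` outside `N`, then it
meets all of them. -/
lemma SimpleGraph.Walk.IsCycle.touches_of_sum {V : Type*} [DecidableEq V] {G : SimpleGraph V}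
    {v : V} {c : G.Walk v v} (hc : c.IsCycle) {ι : Type*} [Fintype ι] {u : ι → V}
    {D : ∀ i, G.Walk (u i) (u i)} (hD : ∀ i, (D i).IsCycle)
    (hsum : ∀ e : Sym2 V, e ∈ c.edges ↔ Odd {i : ι | e ∈ (D i).edges}.ncard)
    {X K : Set V} (hK : ∀ a ∈ K, ∀ b, G.Adj a b → b ∈ K ∨ b ∈ X)
    {H : SimpleGraph V}
    (hH : ∀ i, ∀ x ∈ X, ∀ y ∈ X, x ∈ (D i).support → y ∈ (D i).support → H.Reachable x y)
    {N : Set (Sym2 V)} (hNc : ∀ e ∈ N, e ∈ c.edges)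
    (hN : ∀ y ∈ c.support, ∀ y' ∈ c.support, H.Reachable y y' →
      (SimpleGraph.fromEdgeSet N).Reachable y y')
    {e e' : Sym2 V} (he : e ∈ c.edges) (he' : e' ∈ c.edges) (heN : e ∉ N) (heN' : e' ∉ N)
    (heK : ∃ a ∈ e, a ∈ K) : ∃ a ∈ e', a ∈ K := by
  classical
  by_contra hcon
  have hne : e ≠ e' := fun h => hcon (h ▸ heK)
  obtain ⟨A, hAc, hA⟩ := hc.exists_cut he he' hne
  have hNA : ∀ y y', (SimpleGraph.fromEdgeSet N).Reachable y y' → (y ∈ A ↔ y' ∈ A) :=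
    fun _ _ => mem_iff_mem_of_reachable_fromEdgeSet hNc heN heN' hA
  set g : V → ZMod 2 := fun x => if ∃ y ∈ A, H.Reachable x y then 1 else 0
  have hgH : ∀ x y, H.Reachable x y → g x = g y := by
    intro x y hxy
    have : (∃ z ∈ A, H.Reachable x z) ↔ ∃ z ∈ A, H.Reachable y z :=
      exists_congr fun z => and_congr_right fun _ => ⟨hxy.symm.trans, hxy.trans⟩
    simp only [g, this]
  have hgc : ∀ x ∈ c.support, g x = if x ∈ A then 1 else 0 := by
    intro x hx
    have : (∃ z ∈ A, H.Reachable x z) ↔ x ∈ A :=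
      ⟨fun ⟨z, hz, hxz⟩ => (hNA x z (hN x hx z (hAc z hz) hxz)).2 hz, fun h => ⟨x, h, .rfl⟩⟩
    simp only [g, this]
  set δ : Sym2 V → ZMod 2 := Sym2.lift ⟨fun a b => g a + g b, fun a b => add_comm _ _⟩
  set φ : Sym2 V → ZMod 2 := fun f => if ∃ a ∈ f, a ∈ K then δ f else 0
  have hφD : ∀ i, ∑ f ∈ (D i).edges.toFinset, φ f = 0 := by
    intro i
    obtain ⟨s, hs⟩ : ∃ s : ZMod 2, ∀ x ∈ X, x ∈ (D i).support → g x = s := by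
      by_cases h : ∃ x ∈ X, x ∈ (D i).support
      · obtain ⟨x, hx, hxD⟩ := h
        exact ⟨g x, fun y hy hyD => hgH _ _ (hH i y hy x hx hyD hxD)⟩
      · exact ⟨0, fun x hx hxD => absurd ⟨x, hx, hxD⟩ h⟩
    rw [List.sum_toFinset φ (hD i).edges_nodup,
      sum_map_edges_eq φ (fun x => if x ∈ K then g x + s else 0) (D i) ?_,
      CharTwo.add_self_eq_zero]
    intro x y hxy
    have hadj := (D i).adj_of_mem_edges hxy
    have hxs := (D i).fst_mem_support_of_mem_edges hxy
    have hys := (D i).snd_mem_support_of_mem_edges hxy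
    have hss := CharTwo.add_self_eq_zero s
    simp only [φ, Sym2.mem_iff, exists_eq_or_imp, exists_eq_left, δ, Sym2.lift_mk]
    by_cases hx : x ∈ K <;> by_cases hy : y ∈ K
    · simp only [hx, hy, or_true, if_true]
      linear_combination -hss
    · have := hs y ((hK x hx y hadj).resolve_left hy) hys
      simp [hx, hy, this]
    · have := hs x ((hK y hy x hadj.symm).resolve_left hx) hxs
      simp [hx, hy, this, add_comm]
    · simp [hx, hy]
  have hφc : ∑ f ∈ c.edges.toFinset, φ f = 1 := by
    rw [Finset.sum_eq_single_of_mem e (by simpa using he)]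
    · simp only [φ, if_pos heK]
      induction e with | _ a b
      have ha := hgc a (c.fst_mem_support_of_mem_edges he)
      have hb := hgc b (c.snd_mem_support_of_mem_edges he)
      have := (hA a b he).2 (.inl rfl)
      simp only [δ, Sym2.lift_mk, ha, hb]
      by_cases h₁ : a ∈ A <;> by_cases h₂ : b ∈ A <;> simp_all
    · intro f hf hfe
      rw [List.mem_toFinset] at hf
      simp only [φ]
      split_ifs with hfK
      · induction f with | _ a b
        have ha := hgc a (c.fst_mem_support_of_mem_edges hf)
        have hb := hgc b (c.snd_mem_support_of_mem_edges hf)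
        have hab : a ∈ A ↔ b ∈ A := by
          by_contra h
          rcases (hA a b hf).1 h with h | h
          · exact hfe h
          · exact hcon (h ▸ hfK)
        simp only [δ, Sym2.lift_mk, ha, hb, hab]
        exact CharTwo.add_self_eq_zero _
      · rfl
  have hind : ∀ f : Sym2 V, (if f ∈ c.edges then 1 else 0 : ZMod 2) =
      ∑ i, if f ∈ (D i).edges then 1 else 0 := by
    intro f
    have hcard : {i : ι | f ∈ (D i).edges}.ncard =
        (Finset.univ.filter fun i => f ∈ (D i).edges).card := by
      rw [← Set.ncard_coe_finset]
      congr 1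
      ext
      simp
    rw [Finset.sum_boole]
    by_cases hf : f ∈ c.edges
    · rw [if_pos hf, eq_comm, ZMod.natCast_eq_one_iff_odd, ← hcard]
      exact (hsum f).1 hf
    · rw [if_neg hf, eq_comm, ZMod.natCast_eq_zero_iff_even, ← hcard, ← Nat.not_odd_iff_even]
      exact fun h => hf ((hsum f).2 h)
  set E : Finset (Sym2 V) := c.edges.toFinset ∪ Finset.univ.biUnion fun i => (D i).edges.toFinset
  have hexp : ∀ L : List (Sym2 V), L.toFinset ⊆ E →
      ∑ f ∈ L.toFinset, φ f = ∑ f ∈ E, (if f ∈ L then 1 else 0) * φ f := by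
    intro L hL
    refine Finset.sum_subset_zero_on_sdiff hL (fun f hf => ?_) fun f hf => ?_
    · rw [if_neg (by simpa using (Finset.mem_sdiff.1 hf).2), zero_mul]
    · rw [if_pos (by simpa using hf), one_mul]
  have : ∑ f ∈ c.edges.toFinset, φ f = ∑ i, ∑ f ∈ (D i).edges.toFinset, φ f := by
    rw [hexp _ Finset.subset_union_left]
    simp only [hind, Finset.sum_mul]
    rw [Finset.sum_comm]
    refine Finset.sum_congr rfl fun i _ => (hexp _ ?_).symm
    exact (Finset.subset_biUnion_of_mem (fun i => (D i).edges.toFinset)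
      (Finset.mem_univ i)).trans Finset.subset_union_right
  rw [hφc, Finset.sum_eq_zero fun i _ => hφD i] at this
  exact one_ne_zero this

/-- A vertex set `K` is connected in `G` if any two of its vertices are joined by a walk in `K`. -/
def SimpleGraph.WalkConnected {V : Type*} (G : SimpleGraph V) (K : Set V) : Prop :=
  ∀ a ∈ K, ∀ b ∈ K, ∃ p : G.Walk a b, ∀ z ∈ p.support, z ∈ K

/-- Every set `X` of at most `k` vertices has a component of its complement that meets edges of
the geodesic cycle `c` of total length more than half of that of `c`. -/
lemma exists_connected_meeting_majority {V : Type*} [Fintype V] [DecidableEq V]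
    {G : SimpleGraph V} {k : ℕ} (hk : 0 < k) {r : ℝ} (hr : 0 < r)
    {ℓ : Sym2 V → ℚ} (hℓ : ∀ e ∈ G.edgeSet, 0 < ℓ e) {v : V} {c : G.Walk v v}
    (hc : c.IsCycle) (hgeo : IsGeodesic ℓ c) (hlen : 2 * r * k ≤ (walkLen ℓ c : ℝ))
    {ι : Type*} [Fintype ι] {u : ι → V} {D : ∀ i, G.Walk (u i) (u i)}
    (hD : ∀ i, (D i).IsCycle) (hshort : ∀ i, (walkLen ℓ (D i) : ℝ) ≤ r)
    (hsum : ∀ e : Sym2 V, e ∈ c.edges ↔ Odd {i : ι | e ∈ (D i).edges}.ncard)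
    (X : Finset V) (hX : X.card ≤ k) :
    ∃ (K : Set V) (M : Finset (Sym2 V)), G.WalkConnected K ∧ (∀ a ∈ K, a ∉ X) ∧
      M ⊆ c.edges.toFinset ∧ walkLen ℓ c < 2 * ∑ e ∈ M, ℓ e ∧ ∀ e ∈ M, ∃ a ∈ e, a ∈ K := by
  classical
  let H : SimpleGraph V :=
    { Adj := fun a b => a ≠ b ∧ a ∈ X ∧ b ∈ X ∧ ∃ q : G.Walk a b, 2 * (walkLen ℓ q : ℝ) ≤ r
      symm := ⟨fun a b ⟨hab, ha, hb, q, hq⟩ =>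
        ⟨hab.symm, hb, ha, q.reverse, by rwa [walkLen_reverse]⟩⟩
      loopless := ⟨fun a h => h.1 rfl⟩ }
  have hHD : ∀ i, ∀ x ∈ X, ∀ y ∈ X, x ∈ (D i).support → y ∈ (D i).support →
      H.Reachable x y := by
    intro i x hx y hy hxD hyD
    by_cases hxy : x = y
    · rw [hxy]
    obtain ⟨q, hq⟩ := exists_walk_two_mul_walkLen_le ℓ (D i) hxD hyD
    have hq' : (2 * walkLen ℓ q : ℝ) ≤ walkLen ℓ (D i) := mod_cast hq
    exact SimpleGraph.Adj.reachable (show H.Adj x y from ⟨hxy, hx, hy, q, hq'.trans (hshort i)⟩)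
  obtain ⟨N, hNc, hNlen, hN⟩ := hgeo.exists_joining_edges_lt hℓ (H := H) hr
    (fun a b h => h.2.2.2) (X := X) (fun a b h => h.2.1) hk hX
  have hNc' : ∀ e ∈ (N : Set (Sym2 V)), e ∈ c.edges := fun e he => by simpa using hNc he
  set M := c.edges.toFinset \ N
  have hMc : ∀ e ∈ M, e ∈ c.edges ∧ e ∉ (N : Set (Sym2 V)) := by simp [M]
  have hsplit : ∑ e ∈ M, ℓ e + ∑ e ∈ N, ℓ e = walkLen ℓ c := by
    rw [walkLen_eq_sum ℓ c hc.edges_nodup, Finset.sum_sdiff hNc]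
  have hMlen : walkLen ℓ c < 2 * ∑ e ∈ M, ℓ e := by
    have h₁ : ((∑ e ∈ M, ℓ e : ℚ) : ℝ) + (∑ e ∈ N, ℓ e : ℚ) = walkLen ℓ c := mod_cast hsplit
    have h₂ : (walkLen ℓ c : ℝ) < 2 * (∑ e ∈ M, ℓ e : ℚ) := by linarith
    exact_mod_cast h₂
  have hrk : r ≤ r * k := le_mul_of_one_le_right hr.le (mod_cast hk)
  have hcpos : (0 : ℝ) < walkLen ℓ c := by linarith
  have hMne : M.Nonempty := by
    rw [Finset.nonempty_iff_ne_empty]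
    intro h
    rw [h, Finset.sum_empty, mul_zero] at hMlen
    exact absurd hcpos (not_lt.2 (mod_cast hMlen.le))
  obtain ⟨e, heM⟩ := hMne
  obtain ⟨w, hwe, hwX⟩ : ∃ w ∈ e, w ∉ X := by
    by_contra! hcon
    obtain ⟨i, hi⟩ : ∃ i, e ∈ (D i).edges :=
      Set.nonempty_of_ncard_ne_zero ((hsum e).1 (hMc e heM).1).pos.ne'
    have hMe : M = {e} := by
      refine Finset.eq_singleton_iff_unique_mem.2 ⟨heM, fun e' he' => ?_⟩
      by_contra hne
      obtain ⟨A, -, hA⟩ := hc.exists_cut (hMc e heM).1 (hMc e' he').1 (Ne.symm hne)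
      induction e with | _ a b
      refine (hA a b (hMc _ heM).1).2 (.inl rfl)
        (mem_iff_mem_of_reachable_fromEdgeSet hNc' (hMc _ heM).2 (hMc e' he').2 hA ?_)
      exact hN a (c.fst_mem_support_of_mem_edges (hMc _ heM).1) b
        (c.snd_mem_support_of_mem_edges (hMc _ heM).1)
        (hHD i a (hcon a (by simp)) b (hcon b (by simp))
          ((D i).fst_mem_support_of_mem_edges hi) ((D i).snd_mem_support_of_mem_edges hi))
    rw [hMe, Finset.sum_singleton] at hMlen
    have hle : ℓ e ≤ walkLen ℓ (D i) := by
      refine List.single_le_sum (fun x hx => ?_) _ (List.mem_map_of_mem hi)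
      obtain ⟨f, hf, rfl⟩ := List.mem_map.1 hx
      exact (hℓ f ((D i).edges_subset_edgeSet hf)).le
    have hle' : (ℓ e : ℝ) ≤ walkLen ℓ (D i) := mod_cast hle
    have hMlen' : (walkLen ℓ c : ℝ) < 2 * ℓ e := mod_cast hMlen
    linarith [hshort i]
  refine ⟨{x | ∃ p : G.Walk w x, ∀ z ∈ p.support, z ∉ X}, M, ?_, ?_, Finset.sdiff_subset, hMlen,
    ?_⟩
  · rintro a ⟨p, hp⟩ b ⟨q, hq⟩
    refine ⟨p.reverse.append q, fun z hz => ?_⟩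
    rw [SimpleGraph.Walk.mem_support_append_iff, SimpleGraph.Walk.support_reverse,
      List.mem_reverse] at hz
    rcases hz with hz | hz
    · exact ⟨p.takeUntil z hz, fun x hx => hp x (p.support_takeUntil_subset_support hz hx)⟩
    · exact ⟨q.takeUntil z hz, fun x hx => hq x (q.support_takeUntil_subset_support hz hx)⟩
  · rintro a ⟨p, hp⟩
    exact hp a p.end_mem_support
  · intro e' he'
    refine hc.touches_of_sum hD hsum (X := X) ?_ hHD hNc' hN (hMc e heM).1 (hMc e' he').1
      (hMc e heM).2 (hMc e' he').2 ⟨w, hwe, .nil, by simpa using hwX⟩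
    rintro a ⟨p, hp⟩ b hab
    by_cases hb : b ∈ X
    · exact .inr hb
    · refine .inl ⟨p.concat hab, fun z hz => ?_⟩
      rw [SimpleGraph.Walk.support_concat, List.mem_append, List.mem_singleton] at hz
      rcases hz with hz | rfl
      · exact hp z hz
      · exact hb

/-- The bags meeting a connected vertex set form a subtree. -/
lemma TreeDecomp.pathConvex_bags {V : Type u} {G : SimpleGraph V} (td : TreeDecomp G) {K : Set V}
    (hK : G.WalkConnected K) : td.T.PathConvex {i | ∃ a ∈ K, a ∈ td.bag i} := by
  rintro i j p hp ⟨a, haK, hai⟩ ⟨b, hbK, hbj⟩ k hk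
  obtain ⟨w, hw⟩ := hK a haK b hbK
  induction w generalizing i with
  | nil => exact ⟨_, haK, td.coherent _ p hp hai hbj k hk⟩
  | @cons a a' b hadj w ih =>
    obtain ⟨t, hat, hat'⟩ := td.coversEdges hadj
    obtain ⟨p₁, hp₁⟩ := (td.conn.preconnected i t).exists_isPath
    obtain ⟨p₂, hp₂⟩ := (td.conn.preconnected t j).exists_isPath
    have hk' := td.acyc.path_support_subset hp (p₁.append p₂) hk
    rcases (SimpleGraph.Walk.mem_support_append_iff _ _).1 hk' with h | h
    · exact ⟨a, haK, td.coherent a p₁ hp₁ hai hat k h⟩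
    · exact ih p₂ hp₂ (hw a' (by simp)) hat' hbK hbj h fun z hz => hw z (by simp [hz])

/-- In a finite graph, a tree-decomposition of width less than `k` has bags of size at most `k`. -/
lemma TreeDecomp.ncard_bag_le {V : Type u} [Finite V] {G : SimpleGraph V} (td : TreeDecomp G)
    {k : ℕ} (h : td.width < k) (i : td.ι) : (td.bag i).ncard ≤ k := by
  have hbdd : BddAbove (Set.range fun i => (td.bag i).ncard) :=
    ⟨Nat.card V, by rintro _ ⟨i, rfl⟩; exact Set.ncard_le_card _⟩
  have := le_ciSup hbdd i
  unfold TreeDecomp.width at h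
  omega

/-- The tree-decomposition with a single bag. -/
def TreeDecomp.trivial {V : Type u} (G : SimpleGraph V) : TreeDecomp G where
  ι := PUnit
  T := ⊥
  conn := { preconnected := fun _ _ => .rfl }
  acyc := SimpleGraph.isAcyclic_bot
  bag _ := Set.univ
  covers _ := ⟨.unit, Set.mem_univ _⟩
  coversEdges _ _ _ := ⟨.unit, Set.mem_univ _, Set.mem_univ _⟩
  coherent _ _ _ _ _ _ _ _ _ := Set.mem_univ _

theorem treewidth_ge_of_geodesic_cycle_f2_sum_short
    {V : Type} [Fintype V] (G : SimpleGraph V) (k : ℕ) (hk : 0 < k) (r : ℝ) (hr : 0 < r)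
    (ℓ : Sym2 V → ℚ) (hℓpos : ∀ e ∈ G.edgeSet, 0 < ℓ e)
    (v : V) (c : G.Walk v v) (hc : c.IsCycle) (hgeo : IsGeodesic ℓ c)
    (hlen : 2 * r * k ≤ (walkLen ℓ c : ℝ))
    (ι : Type) [Fintype ι] (u : ι → V) (D : ∀ i, G.Walk (u i) (u i))
    (hD : ∀ i, (D i).IsCycle)
    (hshort : ∀ i, (walkLen ℓ (D i) : ℝ) ≤ r)
    (hsum : ∀ e : Sym2 V, e ∈ c.edges ↔ Odd {i : ι | e ∈ (D i).edges}.ncard) :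
    k ≤ treewidth G := by
  classical
  refine le_csInf ⟨_, TreeDecomp.trivial G, rfl⟩ ?_
  rintro _ ⟨td, rfl⟩
  by_contra! hw
  choose K M hKconn hKX hMc hMlen hMK using fun X : {X : Finset V // X.card ≤ k} =>
    exists_connected_meeting_majority hk hr hℓpos hc hgeo hlen hD hshort hsum X.1 X.2
  have htouch : ∀ X Y, ∃ f ∈ c.edges, (∃ a ∈ f, a ∈ K X) ∧ ∃ a ∈ f, a ∈ K Y := by
    intro X Y
    have hXY : ¬Disjoint (M X) (M Y) := by
      intro hdisj
      have hle : ∑ e ∈ M X ∪ M Y, ℓ e ≤ ∑ e ∈ c.edges.toFinset, ℓ e :=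
        Finset.sum_le_sum_of_subset_of_nonneg (Finset.union_subset (hMc X) (hMc Y))
          fun e he _ => (hℓpos e (c.edges_subset_edgeSet (by simpa using he))).le
      rw [Finset.sum_union hdisj, ← walkLen_eq_sum ℓ c hc.edges_nodup] at hle
      linarith [hMlen X, hMlen Y]
    obtain ⟨f, hfX, hfY⟩ := Finset.not_disjoint_iff.1 hXY
    exact ⟨f, by simpa using hMc X hfX, hMK X f hfX, hMK Y f hfY⟩
  obtain ⟨i, hi⟩ := SimpleGraph.IsTree.helly ⟨td.conn, td.acyc⟩ Finset.univ
    (fun X => {i | ∃ a ∈ K X, a ∈ td.bag i}) (fun X _ => td.pathConvex_bags (hKconn X)) (by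
      intro X _ Y _
      obtain ⟨f, hf, ⟨a, haf, haX⟩, b, hbf, hbY⟩ := htouch X Y
      induction f with | _ x y
      obtain ⟨i, hxi, hyi⟩ := td.coversEdges (c.adj_of_mem_edges hf)
      have hmem : ∀ z ∈ s(x, y), z ∈ td.bag i := by
        intro z hz
        rcases Sym2.mem_iff.1 hz with rfl | rfl
        · exact hxi
        · exact hyi
      exact ⟨i, ⟨a, haX, hmem a haf⟩, b, hbY, hmem b hbf⟩)
  have hcard : (td.bag i).toFinset.card ≤ k := by
    rw [← Set.ncard_eq_toFinset_card']
    exact td.ncard_bag_le hw i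
  obtain ⟨a, haK, hai⟩ := hi ⟨_, hcard⟩ (Finset.mem_univ _)
  exact hKX _ a haK (Set.mem_toFinset.2 hai)
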